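/- Let k ≥ 1 and let A^{(0)},...,A^{(k-1)} be real matrices with A^{(j)} of size n_j × n_{j+1} (indices mod k), such that the associated signed digraph G_{A^{(0)}···A^{(k-1)}} is e-cycle-free. Then for every r ∈ {0,1,...,k-1}, the cyclically rotated product A^{(r)}A^{(r+1)}···A^{(k-1)}A^{(0)}···A^{(r-1)} (an n_r × n_r matrix) is a P0-matrix. -/

import Mathlib

/-- `M` is a P0-matrix: every principal minor is nonnegative. -/
def IsP0Matrix {n : ℕ} (M : Matrix (Fin n) (Fin n) ℝ) : Prop :=
  ∀ α : Finset (Fin n),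
    0 ≤ (M.submatrix (fun i : {x // x ∈ α} => (i : Fin n))
          (fun i : {x // x ∈ α} => (i : Fin n))).det

/-- Product `A^(0) * A^(1) * ⋯ * A^(l-1)`. -/
def matProd0 (n : ℕ → ℕ) (A : ∀ j : ℕ, Matrix (Fin (n j)) (Fin (n (j + 1))) ℝ) :
    (l : ℕ) → Matrix (Fin (n 0)) (Fin (n l)) ℝ
  | 0 => 1
  | l + 1 => matProd0 n A l * A l

/-- The signed digraph associated with the list `A^(0), …, A^(k-1)` contains an e-cycle. -/
def HasECycle (k : ℕ) (n : ℕ → ℕ) (hn : n k = n 0)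
    (A : ∀ j : ℕ, Matrix (Fin (n j)) (Fin (n (j + 1))) ℝ) : Prop :=
  ∃ (m : ℕ) (v : ∀ j : ℕ, ZMod (m + 1) → Fin (n j)),
    (∀ j < k, Function.Injective (v j)) ∧
    (∀ t : ZMod (m + 1), v k t = Fin.cast hn.symm (v 0 (t + 1))) ∧
    (∀ j < k, ∀ t : ZMod (m + 1), A j (v j t) (v (j + 1) t) ≠ 0) ∧
    0 < (-1 : ℝ) ^ (m + 1) *
        ∏ t : ZMod (m + 1), ∏ j ∈ Finset.range k, A j (v j t) (v (j + 1) t)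

/-- `X` lies in the qualitative class of `M`. -/
def InQualClass {p q : ℕ} (X M : Matrix (Fin p) (Fin q) ℝ) : Prop :=
  ∀ i j, (0 < M i j → 0 < X i j) ∧ (M i j < 0 → X i j < 0) ∧ (M i j = 0 → X i j = 0)

/-- Product `A^(a) * A^(a+1) * ⋯ * A^(a+l-1)`. -/
def matProdFrom (n : ℕ → ℕ) (A : ∀ j : ℕ, Matrix (Fin (n j)) (Fin (n (j + 1))) ℝ) :
    (a l : ℕ) → Matrix (Fin (n a)) (Fin (n (a + l))) ℝ
  | a, 0 => show Matrix (Fin (n a)) (Fin (n a)) ℝ from 1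
  | a, l + 1 => matProdFrom n A a l * A (a + l)

open Equiv Equiv.Perm in
/-- An injective enumeration, against the direction of `σ`, of the support of a cycle `σ`. -/
theorem Equiv.Perm.IsCycle.exists_zmod_param {ι : Type*} [Fintype ι] [DecidableEq ι]
    {σ : Perm ι} (hσ : σ.IsCycle) :
    ∃ (m : ℕ) (c : ZMod (m + 1) → ι), Function.Injective c ∧ (∀ t, σ (c (t + 1)) = c t) ∧
      Finset.univ.image c = σ.support ∧ σ.support.card = m + 1 := by
  obtain ⟨x, hx, -⟩ := id hσ
  have hpos : 0 < σ.support.card := Finset.card_pos.2 ⟨x, mem_support.2 hx⟩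
  obtain ⟨m, hm⟩ : ∃ m, σ.support.card = m + 1 := ⟨_, (Nat.succ_pred_eq_of_pos hpos).symm⟩
  have ho : orderOf σ⁻¹ = m + 1 := by rw [orderOf_inv, hσ.orderOf, hm]
  have hx' : σ⁻¹ x ≠ x := fun h => hx (by rw [Perm.inv_eq_iff_eq] at h; exact h.symm)
  have hinj : Function.Injective fun t : ZMod (m + 1) => (σ⁻¹ ^ t.val) x := by
    have key : ∀ s t : ZMod (m + 1), s.val ≤ t.val → (σ⁻¹ ^ s.val) x = (σ⁻¹ ^ t.val) x →
        s = t := by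
      intro s t hst h
      obtain ⟨d, hd⟩ := Nat.exists_eq_add_of_le hst
      rw [hd, pow_add, Perm.mul_apply] at h
      have h1 := (σ⁻¹ ^ s.val).injective h
      have h2 : σ⁻¹ ^ d = 1 := hσ.inv.pow_eq_one_iff.2 ⟨x, hx', h1.symm⟩
      have h3 := orderOf_dvd_of_pow_eq_one h2
      rw [ho] at h3
      have h4 : d = 0 := Nat.eq_zero_of_dvd_of_lt h3 (by have := t.val_lt; omega)
      exact ZMod.val_injective _ (by omega)
    intro s t h
    rcases le_total s.val t.val with hst | hst
    · exact key s t hst h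
    · exact (key t s hst h.symm).symm
  refine ⟨m, fun t => (σ⁻¹ ^ t.val) x, hinj, fun t => ?_, ?_, hm⟩
  · have h : σ⁻¹ ^ (t + 1).val = σ⁻¹ ^ (t.val + 1) := by
      rw [ZMod.val_add, ZMod.val_one_eq_one_mod, Nat.add_mod_mod]
      conv_rhs => rw [← pow_mod_orderOf, ho]
    simp only [h, pow_succ', Perm.mul_apply]
    simp
  · refine Finset.eq_of_subset_of_card_le ?_ ?_
    · intro y hy
      obtain ⟨t, -, rfl⟩ := Finset.mem_image.1 hy
      rw [← support_inv, pow_apply_mem_support, support_inv]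
      exact mem_support.2 hx
    · rw [Finset.card_image_of_injective _ hinj, hm]
      simp [ZMod.card]

open Equiv Equiv.Perm in
/-- If every cycle of `σ` inside its support contributes a nonnegative signed weight, then so does
the restriction of `σ` to its support. -/
theorem sign_mul_prod_support_nonneg {ι : Type*} [Fintype ι] [DecidableEq ι] (x : ι → ℝ)
    (σ : Perm ι)
    (h : ∀ (m : ℕ) (c : ZMod (m + 1) → ι), Function.Injective c →
      (∀ t, σ (c (t + 1)) = c t) → (∀ t, c t ∈ σ.support) →
        0 ≤ (-1 : ℝ) ^ m * ∏ t, x (c t)) :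
    0 ≤ ((sign σ : ℤ) : ℝ) * ∏ i ∈ σ.support, x i := by
  induction σ using cycle_induction_on with
  | base_one => simp
  | base_cycles σ hσ =>
    obtain ⟨m, c, hc, hs, himg, hcard⟩ := hσ.exists_zmod_param
    have := h m c hc hs fun t => himg ▸ Finset.mem_image_of_mem c (Finset.mem_univ t)
    rw [← himg, Finset.prod_image hc.injOn, hσ.sign, hcard]
    simpa [pow_succ] using this
  | induction_disjoint σ τ hd hσ ihσ ihτ =>
    have hsd := hd.disjoint_support
    have h1 := ihσ fun m c hc hs hm => h m c hc
      (fun t => by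
        rw [Perm.mul_apply, notMem_support.1 (Finset.disjoint_left.1 hsd (hm _)), hs])
      (fun t => by rw [hd.support_mul]; exact Finset.mem_union_left _ (hm t))
    have h2 := ihτ fun m c hc hs hm => h m c hc
      (fun t => by
        rw [hd.commute.eq, Perm.mul_apply, notMem_support.1 (Finset.disjoint_right.1 hsd (hm _)),
          hs])
      (fun t => by rw [hd.support_mul]; exact Finset.mem_union_right _ (hm t))
    rw [hd.support_mul, Finset.prod_union hsd, Perm.sign_mul]
    push_cast
    rw [mul_mul_mul_comm]
    exact mul_nonneg h1 h2

open Equiv Equiv.Perm in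
/-- If every cycle of `σ`, fixed points included, contributes a nonnegative signed weight, then
so does `σ`. -/
theorem sign_mul_prod_nonneg {ι : Type*} [Fintype ι] [DecidableEq ι] (x : ι → ℝ) (σ : Perm ι)
    (h : ∀ (m : ℕ) (c : ZMod (m + 1) → ι), Function.Injective c →
      (∀ t, σ (c (t + 1)) = c t) → 0 ≤ (-1 : ℝ) ^ m * ∏ t, x (c t)) :
    0 ≤ ((sign σ : ℤ) : ℝ) * ∏ i, x i := by
  rw [← Finset.prod_mul_prod_compl σ.support, ← mul_assoc]
  refine mul_nonneg (sign_mul_prod_support_nonneg x σ fun m c hc hs _ => h m c hc hs)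
    (Finset.prod_nonneg fun i hi => ?_)
  have hi' : σ i = i := by simpa using hi
  have := h 0 (fun _ => i) (fun s t _ => Subsingleton.elim (α := Fin 1) s t) fun _ => hi'
  simpa using this

open scoped Matrix in
/-- Expansion of the determinant of a product along the columns of the left factor. -/
theorem Matrix.det_mul_eq_sum_submatrix {ι κ : Type*} [Fintype ι] [DecidableEq ι] [Fintype κ]
    (M : Matrix ι κ ℝ) (B : Matrix κ ι ℝ) :
    (M * B).det = ∑ f : ι → κ, (∏ i, B (f i) i) * (M.submatrix id f).det := by
  classical
  have h : (M * B)ᵀ = fun i => ∑ y, B y i • Mᵀ y := by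
    ext i j
    simp [Matrix.mul_apply, mul_comm]
  rw [← Matrix.det_transpose, h]
  change Matrix.detRowAlternating.toMultilinearMap _ = _
  rw [MultilinearMap.map_sum]
  refine Finset.sum_congr rfl fun f _ => ?_
  rw [MultilinearMap.map_smul_univ (Matrix.detRowAlternating (n := ι) (R := ℝ)).toMultilinearMap
      (fun i => B (f i) i) (fun i => Mᵀ (f i)), smul_eq_mul, ← Matrix.det_transpose]
  rfl

/-- A weighted minor of `A^(a) ⋯ A^(a+l-1)` is nonnegative as soon as every family of paths,
vertex-disjoint in all but the last layer, has nonnegative signed weight. -/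
theorem weighted_minor_matProdFrom_nonneg {ι : Type*} [Fintype ι] [DecidableEq ι] (n : ℕ → ℕ)
    (hpos : ∀ j, 0 < n j) (A : ∀ j : ℕ, Matrix (Fin (n j)) (Fin (n (j + 1))) ℝ) (a l : ℕ)
    (e : ι → Fin (n a)) (g : ι → Fin (n (a + l))) (w : ℝ)
    (h : ∀ (f : ∀ j, ι → Fin (n j)) (σ : Equiv.Perm ι), f a = e ∘ σ → f (a + l) = g →
      (∀ j < l, Function.Injective (f (a + j))) →
      0 ≤ w * (((Equiv.Perm.sign σ : ℤ) : ℝ) *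
        ∏ i, ∏ j ∈ Finset.range l, A (a + j) (f (a + j) i) (f (a + j + 1) i))) :
    0 ≤ w * ((matProdFrom n A a l).submatrix e g).det := by
  induction l generalizing w with
  | zero =>
    rw [Matrix.det_apply', Finset.mul_sum]
    refine Finset.sum_nonneg fun σ _ => ?_
    change 0 ≤ w * (((Equiv.Perm.sign σ : ℤ) : ℝ) *
      ∏ i, (1 : Matrix (Fin (n a)) (Fin (n a)) ℝ) (e (σ i)) (g i))
    by_cases hg : g = e ∘ σ
    · have := h (Function.update (fun j _ => ⟨0, hpos j⟩) a g) σ (by simpa using hg)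
        (Function.update_self ..) (by simp)
      have hone : ∏ i, (1 : Matrix (Fin (n a)) (Fin (n a)) ℝ) (e (σ i)) (g i) = 1 :=
        Finset.prod_eq_one fun i _ => by rw [hg]; exact Matrix.one_apply_eq _
      rw [hone]
      simpa using this
    · obtain ⟨i, hi⟩ := Function.ne_iff.1 hg
      have hz : (1 : Matrix (Fin (n a)) (Fin (n a)) ℝ) (e (σ i)) (g i) = 0 :=
        Matrix.one_apply_ne (Ne.symm hi)
      rw [Finset.prod_eq_zero (Finset.mem_univ i) hz]
      simp
  | succ l ih =>
    have hmul : (matProdFrom n A a (l + 1)).submatrix e g =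
        (matProdFrom n A a l).submatrix e id * (A (a + l)).submatrix id g := by
      rw [matProdFrom]
      exact Matrix.submatrix_mul _ _ e id g Function.bijective_id
    rw [hmul, Matrix.det_mul_eq_sum_submatrix, Finset.mul_sum]
    refine Finset.sum_nonneg fun g' _ => ?_
    rw [Matrix.submatrix_submatrix, ← mul_assoc]
    by_cases hg' : Function.Injective g'
    · refine ih g' _ fun f σ hfe hfg hinj => ?_
      have hne : ∀ j ≤ l, a + j ≠ a + (l + 1) := by omega
      have hupd : ∀ j ≤ l, Function.update f (a + (l + 1)) g (a + j) = f (a + j) :=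
        fun j hj => Function.update_of_ne (hne j hj) _ _
      have := h (Function.update f (a + (l + 1)) g) σ ((hupd 0 (Nat.zero_le _)).trans hfe)
        (Function.update_self ..) (fun j hj => by
          rw [hupd j (by omega)]
          rcases Nat.lt_succ_iff_lt_or_eq.1 hj with hj | rfl
          · exact hinj j hj
          · rwa [hfg])
      convert this using 1
      simp only [Finset.prod_range_succ, Finset.prod_mul_distrib, hupd l le_rfl, hfg]
      have hlast : Function.update f (a + (l + 1)) g (a + l + 1) = g := Function.update_self ..
      rw [hlast]
      have hprod : ∀ i, ∏ j ∈ Finset.range l, A (a + j)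
          (Function.update f (a + (l + 1)) g (a + j) i)
          (Function.update f (a + (l + 1)) g (a + j + 1) i) =
          ∏ j ∈ Finset.range l, A (a + j) (f (a + j) i) (f (a + j + 1) i) := fun i =>
        Finset.prod_congr rfl fun j hj => by
          have hj := Finset.mem_range.1 hj
          rw [hupd j hj.le, show Function.update f (a + (l + 1)) g (a + j + 1) = f (a + j + 1) from
            hupd (j + 1) hj]
      simp only [hprod, Matrix.submatrix_apply, id]
      ring
    · obtain ⟨i, i', hii, hne⟩ : ∃ i i', g' i = g' i' ∧ i ≠ i' := by
        simpa [Function.Injective] using hg'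
      rw [Matrix.det_zero_of_column_eq hne (by simp [hii]), mul_zero]

theorem prod_range_rotate {k r : ℕ} (hr : r ≤ k) (G : ℕ → ℝ) :
    ∏ j ∈ Finset.range k, G (if j < r then j + k else j) = ∏ j ∈ Finset.range k, G (r + j) := by
  obtain ⟨d, rfl⟩ := Nat.exists_eq_add_of_le hr
  rw [Finset.prod_range_add, mul_comm]
  conv_rhs => rw [add_comm r d, Finset.prod_range_add]
  congr 1
  · exact Finset.prod_congr rfl fun j _ => by simp
  · refine Finset.prod_congr rfl fun j hj => ?_
    rw [if_pos (Finset.mem_range.1 hj)]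
    congr 1
    omega

/-- A family of vertex-disjoint paths through the layers `r, …, r + k` which closes up along a
sequence of indices `c` to a single cycle of positive parity gives an e-cycle. -/
theorem hasECycle_of_paths {k r : ℕ} (hr : r < k) {n : ℕ → ℕ} (hnper : ∀ j, n (j + k) = n j)
    (hn : n k = n 0) (A : ∀ j : ℕ, Matrix (Fin (n j)) (Fin (n (j + 1))) ℝ)
    (hAper : ∀ j, A (j + k) = (A j).submatrix (Fin.cast (hnper j))
      (Fin.cast (show n (j + k + 1) = n (j + 1) by
        rw [Nat.add_right_comm]; exact hnper (j + 1))))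
    {m : ℕ} (p : ∀ j, ZMod (m + 1) → Fin (n j))
    (hinj : ∀ j < k, Function.Injective (p (r + j)))
    (hclose : ∀ t, p r (t + 1) = Fin.cast (hnper r) (p (r + k) t))
    (hw : 0 < (-1 : ℝ) ^ (m + 1) *
      ∏ t, ∏ j ∈ Finset.range k, A (r + j) (p (r + j) t) (p (r + j + 1) t)) :
    HasECycle k n hn A := by
  let v : ∀ j, ZMod (m + 1) → Fin (n j) := fun j t =>
    if j < r then Fin.cast (hnper j) (p (j + k) (t - 1)) else p j t
  have hlt : ∀ j < r, ∀ t, A j (v j t) (v (j + 1) t) =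
      A (j + k) (p (j + k) (t - 1)) (p (j + k + 1) (t - 1)) := by
    intro j hj t
    have h1 : v j t = Fin.cast (hnper j) (p (j + k) (t - 1)) := if_pos hj
    have hidx : p (j + k + 1) (t - 1) =
        Fin.cast (by rw [Nat.add_right_comm]) (p (j + 1 + k) (t - 1)) := by
      have : ∀ x y (h : x = y), p x (t - 1) = Fin.cast (by rw [h]) (p y (t - 1)) := by
        rintro x _ rfl; rfl
      exact this _ _ (by omega)
    have h2 : v (j + 1) t = Fin.cast (hnper (j + 1)) (p (j + 1 + k) (t - 1)) := by
      rcases Nat.lt_or_eq_of_le (Nat.succ_le_of_lt hj) with h | h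
      · exact if_pos h
      · have h3 : v (j + 1) t = p (j + 1) t := if_neg (by omega)
        rw [h3]
        subst h
        simpa using hclose (t - 1)
    rw [hAper, Matrix.submatrix_apply, h1, h2, hidx]
    rfl
  have hge : ∀ j, r ≤ j → ∀ t, A j (v j t) (v (j + 1) t) = A j (p j t) (p (j + 1) t) := by
    intro j hj t
    have h1 : v j t = p j t := if_neg (by omega)
    have h2 : v (j + 1) t = p (j + 1) t := if_neg (by omega)
    rw [h1, h2]
  let G : ℕ → ℝ := fun j => ∏ t, A j (p j t) (p (j + 1) t)
  have hprod : ∏ t, ∏ j ∈ Finset.range k, A j (v j t) (v (j + 1) t) =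
      ∏ t, ∏ j ∈ Finset.range k, A (r + j) (p (r + j) t) (p (r + j + 1) t) := by
    rw [Finset.prod_comm]
    conv_rhs => rw [Finset.prod_comm]
    refine Eq.trans (Finset.prod_congr rfl fun j _ => ?_) (prod_range_rotate hr.le G)
    by_cases hj : j < r
    · rw [if_pos hj]
      simp only [hlt j hj]
      exact Fintype.prod_equiv (Equiv.subRight 1) _ _ fun _ => rfl
    · rw [if_neg hj]
      exact Finset.prod_congr rfl fun t _ => hge j (by omega) t
  rw [← hprod] at hw
  refine ⟨m, v, fun j hj => ?_, fun t => ?_, fun j hj t h0 => ?_, hw⟩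
  · by_cases hjr : j < r
    · obtain ⟨d, hd⟩ := Nat.exists_eq_add_of_le (show r ≤ j + k by omega)
      intro s t hst
      simp only [v, if_pos hjr] at hst
      exact sub_left_injective ((hd ▸ hinj d (by omega)) (Fin.cast_injective _ hst))
    · obtain ⟨d, rfl⟩ := Nat.exists_eq_add_of_le (show r ≤ j by omega)
      have : v (r + d) = p (r + d) := funext fun t => if_neg hjr
      exact this ▸ hinj d (by omega)
  · have h1 : v k t = p k t := if_neg (by omega)
    have hidx : ∀ x (h : x = k), p k t = Fin.cast (by rw [h]) (p x t) := by
      rintro _ rfl; rfl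
    rw [h1, hidx (0 + k) (zero_add k)]
    by_cases h0 : 0 < r
    · have h2 : v 0 (t + 1) = Fin.cast (hnper 0) (p (0 + k) (t + 1 - 1)) := if_pos h0
      rw [h2, add_sub_cancel_right]
      rfl
    · obtain rfl : r = 0 := by omega
      have h2 : v 0 (t + 1) = p 0 (t + 1) := if_neg h0
      rw [h2, hclose]
      rfl
  · rw [Finset.prod_eq_zero (Finset.mem_univ t)
      (Finset.prod_eq_zero (Finset.mem_range.2 hj) h0)] at hw
    simp at hw

theorem stmt12 (k : ℕ) (hk : 1 ≤ k) (n : ℕ → ℕ) (hpos : ∀ j, 0 < n j)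
    (hnper : ∀ j, n (j + k) = n j) (hn : n k = n 0)
    (A : ∀ j : ℕ, Matrix (Fin (n j)) (Fin (n (j + 1))) ℝ)
    (hAper : ∀ j, A (j + k) = (A j).submatrix (Fin.cast (hnper j))
      (Fin.cast (show n (j + k + 1) = n (j + 1) by
        rw [Nat.add_right_comm]; exact hnper (j + 1))))
    (hfree : ¬ HasECycle k n hn A) :
    ∀ r < k, IsP0Matrix ((matProdFrom n A r k).submatrix id (Fin.cast (hnper r).symm)) := by
  intro r hr α
  rw [Matrix.submatrix_submatrix, ← one_mul (Matrix.det _)]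
  refine weighted_minor_matProdFrom_nonneg n hpos A r k _ _ 1 fun f σ hfr hfk hinj => ?_
  rw [one_mul]
  refine sign_mul_prod_nonneg _ σ fun m c hc hs => ?_
  by_contra! hneg
  refine hfree (hasECycle_of_paths hr hnper hn A hAper (fun j t => f j (c t))
    (fun j hj => (hinj j hj).comp hc) (fun t => ?_) ?_)
  · simp [hfr, hfk, hs]
  · rw [pow_succ]
    linarith
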